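/- Let v be a positive multiple of 4 and let r ≥ 3 be an integer. On ℂ^{(({0,1}^n)^v)} ⊗ (ℓ-boson space), define Π_succ = ∑ |z_1,…,z_v⟩⟨z_1,…,z_v| ⊗ Π_{z_1,…,z_v}, where the sum is over pairwise-distinct tuples (z_1,…,z_v) ∈ ({0,1}^n)^v and Π_{z_1,…,z_v} is the orthogonal projection onto the span of position Fock basis states |u⟩ with u_{z_i} ≥ 1 for every i. Then ‖(id ⊗ QEC_{(r, v/4)}) · Π_succ · (id ⊗ QEC_{(r, v/4)})‖_op ≤ 2 · (4v(r³ + v r²) √ℓ / 2^{n/4})^v. -/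

import Mathlib

open scoped BigOperators

/-- The group `{0,1}^n` with bitwise XOR as addition. -/
abbrev BV (n : ℕ) : Type := Fin n → ZMod 2

/-- Occupation tuples: functions assigning a number of bosons to each mode. -/
abbrev OccT (n : ℕ) : Type := BV n → ℕ

/-- The full bosonic Fock space: formal (finitely supported) complex combinations of
position Fock basis states `|u⟩`, one for each occupation tuple `u`. -/
abbrev FockV (n : ℕ) : Type := OccT n →₀ ℂ

/-- Operators on the Fock space. -/
abbrev FockOp (n : ℕ) : Type := Module.End ℂ (FockV n)

/-- The annihilation operator `â_x`: on basis states, `â_x|u⟩ = √(u_x)|u − 1_x⟩`. -/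
noncomputable def ann (n : ℕ) (x : BV n) : FockOp n :=
  Finsupp.lift (FockV n) ℂ (OccT n) fun u =>
    ((Real.sqrt (u x) : ℝ) : ℂ) • Finsupp.single (Function.update u x (u x - 1)) 1

/-- The creation operator `â_x†`: on basis states, `â_x†|u⟩ = √(u_x + 1)|u + 1_x⟩`. -/
noncomputable def cre (n : ℕ) (x : BV n) : FockOp n :=
  Finsupp.lift (FockV n) ℂ (OccT n) fun u =>
    ((Real.sqrt (u x + 1) : ℝ) : ℂ) • Finsupp.single (Function.update u x (u x + 1)) 1

/-- The number operator `n̂_z = â_z† â_z`. -/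
noncomputable def numOp (n : ℕ) (z : BV n) : FockOp n := cre n z * ann n z

/-- The sign `(−1)^{x·y}` (as a real number), `x·y` the mod-2 inner product. -/
noncomputable def chiR {n : ℕ} (x y : BV n) : ℝ :=
  if (∑ j, x j * y j : ZMod 2) = 0 then 1 else -1

/-- The momentum annihilation operator `ã_y = 2^{−n/2} ∑_x (−1)^{x·y} â_x`. -/
noncomputable def mann (n : ℕ) (y : BV n) : FockOp n :=
  (((Real.sqrt ((2 : ℝ) ^ n))⁻¹ : ℝ) : ℂ) • ∑ x : BV n, ((chiR x y : ℝ) : ℂ) • ann n x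

/-- The momentum creation operator `ã_y† = 2^{−n/2} ∑_x (−1)^{x·y} â_x†`. -/
noncomputable def mcre (n : ℕ) (y : BV n) : FockOp n :=
  (((Real.sqrt ((2 : ℝ) ^ n))⁻¹ : ℝ) : ℂ) • ∑ x : BV n, ((chiR x y : ℝ) : ℂ) • cre n x

/-- The vacuum state `|vac⟩`. -/
noncomputable def vac (n : ℕ) : FockV n := Finsupp.single 0 1

/-- The momentum Fock state `|ũ⟩ = (∏_x (ã_x†)^{u_x}/√(u_x!)) |vac⟩`. -/
noncomputable def momFock (n : ℕ) (u : OccT n) : FockV n :=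
  (((∏ x : BV n, Real.sqrt ((u x).factorial) : ℝ)⁻¹ : ℝ) : ℂ) •
    ((Finset.univ.toList (α := BV n)).map fun x => (mcre n x) ^ (u x)).prod (vac n)

/-- The number of modes `x ≠ 0` with an odd number of bosons. -/
def oddCount (n : ℕ) (u : OccT n) : ℕ :=
  (Finset.univ.filter fun x : BV n => x ≠ 0 ∧ Odd (u x)).card

/-- The orthogonal projection (in the `ℓ`-boson space) onto the span of the momentum Fock
states `|ũ⟩` over occupation tuples `u` with `∑_x u_x = ℓ` satisfying `P`.  Since the
momentum Fock states `{|ũ⟩ : ∑ u = ℓ}` form an orthonormal basis of the `ℓ`-boson space,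
this projection equals `∑_u |ũ⟩⟨ũ|`, which on a position basis state `|w⟩` gives
`∑_u conj(⟨w|ũ⟩) |ũ⟩`. -/
noncomputable def projOn (n ℓ : ℕ) (P : OccT n → Prop) [DecidablePred P] : FockOp n :=
  Finsupp.lift (FockV n) ℂ (OccT n) fun w =>
    ∑ v : BV n → Fin (ℓ + 1),
      if (∑ x, ((v x : ℕ))) = ℓ ∧ P (fun x => (v x : ℕ))
      then (starRingEnd ℂ) (momFock n (fun x => (v x : ℕ)) w) • momFock n (fun x => (v x : ℕ))
      else 0

/-- `Con_r` (`conProj`): the projection onto the span of momentum Fock states of `r`-condensate tuples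
(`ℓ`-boson tuples with at least `ℓ − r` bosons in the `0`-momentum mode). -/
noncomputable def conProj (n ℓ r : ℕ) : FockOp n :=
  projOn n ℓ fun u => ℓ - r ≤ u 0

/-- `QEC_{(r,o)}`: the projection onto the span of momentum Fock states of
`(r,o)`-quasi-even condensate tuples. -/
noncomputable def QEC (n ℓ r o : ℕ) : FockOp n :=
  projOn n ℓ fun u => ℓ - r ≤ u 0 ∧ oddCount n u ≤ o

/-- `QE_{=o}`: the projection onto momentum Fock states with exactly `o` odd
nonzero-momentum modes. -/
noncomputable def QEeq (n ℓ o : ℕ) : FockOp n :=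
  projOn n ℓ fun u => oddCount n u = o

/-- `QEC_{(R,=o)}`: the projection onto momentum Fock states of `R`-condensate tuples with
exactly `o` odd nonzero-momentum modes. -/
noncomputable def QECeq (n ℓ R o : ℕ) : FockOp n :=
  projOn n ℓ fun u => (ℓ - R ≤ u 0 ∧ oddCount n u = o)

/-- The squared Hilbert norm `‖ψ‖² = ∑_u |ψ_u|²`. -/
noncomputable def nsq (n : ℕ) (ψ : FockV n) : ℝ := ψ.sum fun _ c => Complex.normSq c

/-- The inner product `⟨φ, ψ⟩ = ∑_u conj(φ_u) ψ_u` (antilinear in the first argument). -/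
noncomputable def finner (n : ℕ) (φ ψ : FockV n) : ℂ :=
  φ.sum fun u c => (starRingEnd ℂ) c * ψ u

/-- The single `y`-momentum hopping operator `G̃_y = ℓ^{−1/2} ∑_x ã_{x⊕y}† ã_x`. -/
noncomputable def sHop (n ℓ : ℕ) (y : BV n) : FockOp n :=
  (((Real.sqrt (ℓ : ℝ))⁻¹ : ℝ) : ℂ) • ∑ x : BV n, mcre n (x + y) * mann n x

/-- The double `y`-momentum hopping operator
`H̃_y = ℓ^{−1} ∑_{x,x'} ã_{x⊕y}† ã_{x'⊕y}† ã_x ã_{x'}`. -/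
noncomputable def dHop (n ℓ : ℕ) (y : BV n) : FockOp n :=
  ((ℓ : ℂ))⁻¹ • ∑ x : BV n, ∑ x' : BV n,
    mcre n (x + y) * mcre n (x' + y) * mann n x * mann n x'

/-- Basis indices of the combined space `ℂ^{({0,1}^n)^v} ⊗ (ℓ-boson space)`:
a tuple of `v` guesses together with an occupation tuple. -/
abbrev WIdx (n v : ℕ) : Type := (Fin v → BV n) × OccT n

/-- The combined space, as formal complex combinations of its basis. -/
abbrev WSp (n v : ℕ) : Type := WIdx n v →₀ ℂ

/-- `id ⊗ A`: apply `A` on the Fock factor, identity on the guess register. -/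
noncomputable def tensorR (n v : ℕ) (A : FockOp n) : Module.End ℂ (WSp n v) :=
  Finsupp.lift (WSp n v) ℂ (WIdx n v) fun p =>
    Finsupp.mapDomain (fun u => (p.1, u)) (A (Finsupp.single p.2 1))

/-- `Π_succ = ∑_{distinct (z_1,…,z_v)} |z⟩⟨z| ⊗ Π_{z_1,…,z_v}` where `Π_{z_1,…,z_v}`
projects onto the position Fock basis states of `ℓ` bosons with at least one boson in
each of the position modes `z_1, …, z_v`. -/
noncomputable def succProj (n ℓ v : ℕ) : Module.End ℂ (WSp n v) :=
  Finsupp.lift (WSp n v) ℂ (WIdx n v) fun p =>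
    if Function.Injective p.1 ∧ (∑ x, p.2 x) = ℓ ∧ ∀ i : Fin v, 1 ≤ p.2 (p.1 i)
    then Finsupp.single p 1 else 0

/-- The squared Hilbert norm on the combined space. -/
noncomputable def nsqW (n v : ℕ) (ψ : WSp n v) : ℝ := ψ.sum fun _ c => Complex.normSq c

section helpers

lemma ann_single (n : ℕ) (x : BV n) (u : OccT n) (c : ℂ) :
    ann n x (Finsupp.single u c) =
      Finsupp.single (Function.update u x (u x - 1)) (c * ((Real.sqrt (u x) : ℝ) : ℂ)) := by
  simp [ann]

lemma cre_single (n : ℕ) (x : BV n) (u : OccT n) (c : ℂ) :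
    cre n x (Finsupp.single u c) =
      Finsupp.single (Function.update u x (u x + 1)) (c * ((Real.sqrt (u x + 1) : ℝ) : ℂ)) := by
  simp [cre]

lemma ann_apply (n : ℕ) (x : BV n) (φ : FockV n) (w : OccT n) :
    ann n x φ w = ((Real.sqrt (w x + 1) : ℝ) : ℂ) * φ (Function.update w x (w x + 1)) := by
  induction φ using Finsupp.induction_linear with
  | zero => simp
  | add f g hf hg => simp [hf, hg, mul_add]
  | single u c =>
    rw [ann_single, Finsupp.single_apply, Finsupp.single_apply]
    by_cases h0 : u x = 0
    · have : u ≠ Function.update w x (w x + 1) := by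
        intro h
        have := congrFun h x
        simp at this
        omega
      simp [h0, this]
    · by_cases h : u = Function.update w x (w x + 1)
      · have h2 : Function.update u x (u x - 1) = w := by
          subst h; simp
        rw [if_pos h2, if_pos h]
        have : u x = w x + 1 := by rw [h]; simp
        rw [this]; push_cast; ring
      · have h2 : Function.update u x (u x - 1) ≠ w := by
          rintro rfl
          apply h
          funext y
          by_cases hy : y = x
          · subst hy; simp; omega
          · simp [hy]
        rw [if_neg h2, if_neg h]; simp

lemma sqrt_mul_self_c (a : ℝ) (ha : 0 ≤ a) :
    ((Real.sqrt a : ℝ) : ℂ) * ((Real.sqrt a : ℝ) : ℂ) = (a : ℂ) := by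
  rw [← Complex.ofReal_mul, Real.mul_self_sqrt ha]

lemma ccr_pos (n : ℕ) (x y : BV n) :
    ann n x * cre n y = cre n y * ann n x + (if x = y then (1 : ℂ) else 0) • (1 : FockOp n) := by
  apply Finsupp.lhom_ext
  intro u c
  simp only [Module.End.mul_apply, LinearMap.add_apply, LinearMap.smul_apply, Module.End.one_apply]
  rw [cre_single, ann_single, ann_single, cre_single]
  by_cases h : x = y
  · subst h
    simp only [Function.update_self, Function.update_idem, if_true, one_smul]
    have e1 : Function.update u x (u x + 1 - 1) = u := by simp
    rw [e1]
    rcases Nat.eq_zero_or_pos (u x) with h0 | h0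
    · simp [h0]
    · have e2 : u x - 1 + 1 = u x := by omega
      rw [e2, Function.update_eq_self, ← Finsupp.single_add]
      congr 1
      have e3 : ((u x - 1 : ℕ) : ℝ) + 1 = u x := by exact_mod_cast e2
      rw [e3]
      push_cast
      rw [mul_assoc, mul_assoc, sqrt_mul_self_c _ (by positivity), sqrt_mul_self_c _ (by positivity)]
      push_cast; ring
  · have h' : y ≠ x := fun e => h e.symm
    simp only [h, if_false, zero_smul, add_zero]
    rw [Function.update_of_ne h, Function.update_of_ne h', Function.update_comm h]
    congr 1
    ring

lemma cre_comm (n : ℕ) (x y : BV n) : cre n x * cre n y = cre n y * cre n x := by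
  apply Finsupp.lhom_ext
  intro u c
  simp only [Module.End.mul_apply]
  rw [cre_single, cre_single, cre_single, cre_single]
  by_cases h : x = y
  · subst h; rfl
  · have h' : y ≠ x := fun e => h e.symm
    rw [Function.update_of_ne h, Function.update_of_ne h', Function.update_comm h]
    congr 1
    ring

lemma ann_vac (n : ℕ) (x : BV n) : ann n x (vac n) = 0 := by
  simp [vac, ann_single]

lemma chiR_symm {n : ℕ} (x y : BV n) : chiR x y = chiR y x := by
  simp [chiR, mul_comm]

lemma chiR_add {n : ℕ} (x y z : BV n) : chiR x (y + z) = chiR x y * chiR x z := by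
  have key : ∀ a b : ZMod 2, (if a + b = 0 then (1 : ℝ) else -1) =
      (if a = 0 then (1 : ℝ) else -1) * (if b = 0 then (1 : ℝ) else -1) := by
    intro a b
    have h : ∀ a : ZMod 2, a = 0 ∨ a = 1 := by decide
    have h11 : (1 + 1 : ZMod 2) = 0 := by decide
    rcases h a with rfl | rfl <;> rcases h b with rfl | rfl <;> simp [h11]
  simp only [chiR, Pi.add_apply, mul_add, Finset.sum_add_distrib]
  exact key _ _

lemma chiR_abs {n : ℕ} (x y : BV n) : |chiR x y| = 1 := by
  unfold chiR; split_ifs <;> simp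

lemma chiR_sum {n : ℕ} (x : BV n) : ∑ y, chiR x y = if x = 0 then (2 : ℝ) ^ n else 0 := by
  split_ifs with h
  · subst h
    simp [chiR]
  · obtain ⟨j, hj⟩ : ∃ j, x j ≠ 0 := by
      by_contra hc
      push Not at hc
      exact h (funext hc)
    have e1 : chiR x (Pi.single j 1) = -1 := by
      simp [chiR, Pi.single_apply, hj]
    have e2 : ∑ y, chiR x y = ∑ y, chiR x (y + Pi.single j 1) :=
      (Equiv.sum_comp (Equiv.addRight (Pi.single j 1)) (fun y => chiR x y)).symm
    simp only [chiR_add, e1] at e2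
    rw [← Finset.sum_mul] at e2
    linarith

lemma chiR_orth {n : ℕ} (x y : BV n) :
    ∑ z, chiR z x * chiR z y = if x = y then (2 : ℝ) ^ n else 0 := by
  have : ∀ z, chiR z x * chiR z y = chiR (x + y) z := by
    intro z; rw [← chiR_add, chiR_symm]
  simp only [this, chiR_sum]
  have hh : x + y = 0 ↔ x = y := by
    constructor
    · intro h
      funext j
      have := congrFun h j
      have k : ∀ a b : ZMod 2, a + b = 0 → a = b := by decide
      exact k _ _ this
    · rintro rfl
      funext j
      have k : ∀ a : ZMod 2, a + a = 0 := by decide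
      exact k _
  simp [hh]

lemma chiR_orthC {n : ℕ} (x y : BV n) :
    ∑ z, ((chiR z x : ℝ) : ℂ) * ((chiR z y : ℝ) : ℂ) = if x = y then (2 : ℂ) ^ n else 0 := by
  have := congrArg (fun a : ℝ => (a : ℂ)) (chiR_orth x y)
  push_cast at this
  rw [this]; split_ifs <;> simp

lemma sinv_sq (n : ℕ) : (((Real.sqrt ((2 : ℝ) ^ n))⁻¹ : ℝ) : ℂ) * (((Real.sqrt ((2 : ℝ) ^ n))⁻¹ : ℝ) : ℂ)
    * (2 : ℂ) ^ n = 1 := by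
  have : (Real.sqrt ((2 : ℝ) ^ n))⁻¹ * (Real.sqrt ((2 : ℝ) ^ n))⁻¹ * (2 : ℝ) ^ n = 1 := by
    rw [← mul_inv, Real.mul_self_sqrt (by positivity)]
    field_simp
  exact_mod_cast congrArg (fun a : ℝ => (a : ℂ)) this

lemma mcre_comm (n : ℕ) (x y : BV n) : mcre n x * mcre n y = mcre n y * mcre n x := by
  have h : Commute (mcre n x) (mcre n y) := by
    unfold mcre
    refine Commute.smul_left (Commute.smul_right ?_ _) _
    refine Commute.sum_left _ _ _ fun i _ => Commute.sum_right _ _ _ fun j _ => ?_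
    exact Commute.smul_left (Commute.smul_right (cre_comm n i j) _) _
  exact h

lemma ccr_mom (n : ℕ) (x y : BV n) :
    mann n x * mcre n y = mcre n y * mann n x + (if x = y then (1 : ℂ) else 0) • (1 : FockOp n) := by
  unfold mann mcre
  generalize hs : (((Real.sqrt ((2 : ℝ) ^ n))⁻¹ : ℝ) : ℂ) = s
  have hs2 : s * s * (2 : ℂ) ^ n = 1 := by rw [← hs]; exact sinv_sq n
  simp only [smul_mul_assoc, mul_smul_comm, Finset.sum_mul, Finset.mul_sum, ccr_pos, smul_add,
    Finset.sum_add_distrib, Finset.smul_sum, smul_smul]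
  have e1 : ∑ i : BV n, ∑ j : BV n, (s * ((chiR i x : ℝ) : ℂ) * (s * ((chiR j y : ℝ) : ℂ))) • (cre n j * ann n i)
      = ∑ i : BV n, ∑ j : BV n, (s * ((chiR i y : ℝ) : ℂ) * (s * ((chiR j x : ℝ) : ℂ))) • (cre n i * ann n j) := by
    rw [Finset.sum_comm]
    refine Finset.sum_congr rfl fun i _ => Finset.sum_congr rfl fun j _ => ?_
    congr 1; ring
  rw [e1]
  refine congrArg₂ (· + ·) rfl ?_
  simp only [← Finset.sum_smul]
  congr 1
  have e2 : ∀ i : BV n, ∑ j : BV n, s * ((chiR i y : ℝ) : ℂ) * (s * ((chiR j x : ℝ) : ℂ) * if j = i then 1 else 0)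
      = (s * s) * (((chiR i x : ℝ) : ℂ) * ((chiR i y : ℝ) : ℂ)) := by
    intro i
    simp
    ring
  simp only [e2, ← Finset.mul_sum, chiR_orthC]
  split_ifs
  · exact hs2
  · simp

lemma mann_vac (n : ℕ) (x : BV n) : mann n x (vac n) = 0 := by
  simp [mann, ann_vac]

/-- inverse Fourier transform -/
lemma ann_eq_sum_mann (n : ℕ) (x : BV n) :
    ann n x = (((Real.sqrt ((2 : ℝ) ^ n))⁻¹ : ℝ) : ℂ) • ∑ y : BV n, ((chiR y x : ℝ) : ℂ) • mann n y := by
  unfold mann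
  generalize hs : (((Real.sqrt ((2 : ℝ) ^ n))⁻¹ : ℝ) : ℂ) = s
  have hs2 : s * s * (2 : ℂ) ^ n = 1 := by rw [← hs]; exact sinv_sq n
  simp only [Finset.smul_sum, smul_smul]
  rw [Finset.sum_comm]
  have e : ∀ z : BV n, ∑ y : BV n, (s * (((chiR y x : ℝ) : ℂ) * (s * ((chiR z y : ℝ) : ℂ)))) • ann n z
      = (if x = z then (1 : ℂ) else 0) • ann n z := by
    intro z
    rw [← Finset.sum_smul]
    congr 1
    have : ∀ y : BV n, s * (((chiR y x : ℝ) : ℂ) * (s * ((chiR z y : ℝ) : ℂ)))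
        = (s * s) * (((chiR y x : ℝ) : ℂ) * ((chiR y z : ℝ) : ℂ)) := by
      intro y; rw [chiR_symm z y]; ring
    simp only [this, ← Finset.mul_sum, chiR_orthC]
    split_ifs
    · exact hs2
    · simp
  calc ann n x = ∑ z : BV n, (if x = z then (1 : ℂ) else 0) • ann n z := by simp
    _ = _ := by
      refine Finset.sum_congr rfl fun z _ => ?_
      rw [← e z]

lemma list_prod_update (n : ℕ) (u : OccT n) (y : BV n) (l : List (BV n)) (hl : l.Nodup) :
    (l.map fun x => (mcre n x) ^ (Function.update u y (u y + 1) x)).prod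
      = (if y ∈ l then mcre n y else 1) * (l.map fun x => (mcre n x) ^ (u x)).prod := by
  induction l with
  | nil => simp
  | cons a l ih =>
    have hl' := (List.nodup_cons.1 hl)
    simp only [List.map_cons, List.prod_cons, ih hl'.2]
    by_cases hay : a = y
    · subst hay
      simp [hl'.1, pow_succ', mul_assoc]
    · have hya : ¬ y = a := fun h => hay h.symm
      rw [Function.update_of_ne hay]
      by_cases hy : y ∈ l
      · simp only [hy, hya, if_true, List.mem_cons, or_true]
        have hc : Commute (mcre n a ^ u a) (mcre n y) := (show Commute (mcre n a) (mcre n y) from mcre_comm n a y).pow_left _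
        rw [← mul_assoc, ← mul_assoc, hc.eq]
      · simp [hy, hya]

lemma mcre_momFock (n : ℕ) (u : OccT n) (y : BV n) :
    mcre n y (momFock n u) =
      ((Real.sqrt (u y + 1) : ℝ) : ℂ) • momFock n (Function.update u y (u y + 1)) := by
  unfold momFock
  rw [list_prod_update n u y _ (Finset.nodup_toList _)]
  simp only [Finset.mem_toList, Finset.mem_univ, if_true, Module.End.mul_apply, map_smul, smul_smul]
  congr 1
  rw [← Complex.ofReal_mul]
  congr 1
  have h1 : ∏ x : BV n, Real.sqrt ((Function.update u y (u y + 1) x).factorial)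
      = Real.sqrt (u y + 1) * ∏ x : BV n, Real.sqrt ((u x).factorial) := by
    rw [← Finset.mul_prod_erase _ _ (Finset.mem_univ y), ← Finset.mul_prod_erase _ _ (Finset.mem_univ y),
      ← mul_assoc]
    congr 1
    · rw [Function.update_self, ← Real.sqrt_mul (by positivity), Nat.factorial_succ]
      push_cast; rfl
    · refine Finset.prod_congr rfl fun x hx => ?_
      rw [Function.update_of_ne (Finset.ne_of_mem_erase hx)]
  rw [h1, mul_inv, ← mul_assoc, mul_inv_cancel₀ (by positivity), one_mul]

lemma momFock_zero (n : ℕ) : momFock n 0 = vac n := by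
  simp [momFock]

/-- The change of basis sending position Fock states to momentum Fock states. -/
noncomputable def cob (n : ℕ) : FockOp n := Finsupp.lift (FockV n) ℂ (OccT n) (momFock n)

lemma cob_single (n : ℕ) (u : OccT n) (c : ℂ) : cob n (Finsupp.single u c) = c • momFock n u := by
  simp [cob]

lemma cob_cre (n : ℕ) (y : BV n) (φ : FockV n) : cob n (cre n y φ) = mcre n y (cob n φ) := by
  induction φ using Finsupp.induction_linear with
  | zero => simp
  | add f g hf hg => simp [hf, hg]
  | single u c =>
    rw [cre_single, cob_single, cob_single, map_smul, mcre_momFock, smul_smul]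

lemma cob_vac (n : ℕ) : cob n (vac n) = vac n := by
  rw [vac, cob_single, momFock_zero, one_smul, vac]

/-- Every predicate closed under linear combinations and creation that holds for the vacuum holds. -/
lemma fock_induction (n : ℕ) (P : FockV n → Prop) (hv : P (vac n))
    (hadd : ∀ f g, P f → P g → P (f + g)) (hsmul : ∀ (c : ℂ) f, P f → P (c • f))
    (hcre : ∀ x f, P f → P (cre n x f)) (φ : FockV n) : P φ := by
  have hs : ∀ (k : ℕ) (u : OccT n), ∑ x, u x = k → P (Finsupp.single u 1) := by
    intro k
    induction k with
    | zero =>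
      intro u hu
      have : u = 0 := by
        funext x
        exact (Finset.sum_eq_zero_iff.1 hu) x (Finset.mem_univ x)
      rw [this]; exact hv
    | succ k ih =>
      intro u hu
      obtain ⟨x, hx⟩ : ∃ x, u x ≠ 0 := by
        by_contra hc
        push Not at hc
        simp [hc] at hu
      set w := Function.update u x (u x - 1) with hw
      have hwx : w x + 1 = u x := by simp [hw]; omega
      have huw : Function.update w x (w x + 1) = u := by rw [hwx, hw]; simp
      have hwk : ∑ y, w y = k := by
        have e1 := Finset.add_sum_erase Finset.univ u (Finset.mem_univ x)
        have e2 := Finset.add_sum_erase Finset.univ w (Finset.mem_univ x)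
        have e3 : ∑ y ∈ Finset.univ.erase x, w y = ∑ y ∈ Finset.univ.erase x, u y := by
          refine Finset.sum_congr rfl fun y hy => ?_
          rw [hw, Function.update_of_ne (Finset.ne_of_mem_erase hy)]
        omega
      have h1 := hcre x _ (ih w hwk)
      rw [cre_single, huw, one_mul] at h1
      have h2 := hsmul (((Real.sqrt (w x + 1) : ℝ) : ℂ)⁻¹) _ h1
      rw [Finsupp.smul_single, smul_eq_mul, inv_mul_cancel₀] at h2
      · exact h2
      · have : Real.sqrt (w x + 1) ≠ 0 := by positivity
        exact_mod_cast this
  induction φ using Finsupp.induction_linear with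
  | zero => simpa using hsmul 0 _ hv
  | add f g hf hg => exact hadd _ _ hf hg
  | single u c => simpa using hsmul c _ (hs _ u rfl)

lemma cob_ann (n : ℕ) (y : BV n) (φ : FockV n) : cob n (ann n y φ) = mann n y (cob n φ) := by
  refine fock_induction n (fun φ => cob n (ann n y φ) = mann n y (cob n φ)) ?_ ?_ ?_ ?_ φ
  · rw [ann_vac, cob_vac, mann_vac, map_zero]
  · intro f g hf hg; simp [hf, hg]
  · intro c f hf; simp [hf]
  · intro x f hf
    have h1 := congrArg (fun T : FockOp n => T f) (ccr_pos n y x)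
    have h2 := congrArg (fun T : FockOp n => T (cob n f)) (ccr_mom n y x)
    simp only [Module.End.mul_apply, LinearMap.add_apply, LinearMap.smul_apply,
      Module.End.one_apply] at h1 h2
    rw [h1, map_add, cob_cre, hf, cob_cre, h2, map_smul]

lemma ann_cob (n : ℕ) (y : BV n) (φ : FockV n) : ann n y (cob n φ) = cob n (mann n y φ) := by
  rw [ann_eq_sum_mann n y, mann]
  simp [cob_ann, chiR_symm]

/-- `finner` as a sesquilinear map. -/
noncomputable def sip (n : ℕ) : FockV n →ₗ⋆[ℂ] FockV n →ₗ[ℂ] ℂ :=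
  LinearMap.mk₂'ₛₗ (starRingEnd ℂ) (RingHom.id ℂ) (finner n)
    (by
      intro f g h
      unfold finner
      exact Finsupp.sum_add_index' (by simp) (by intros; simp [add_mul]))
    (by
      intro c f g
      unfold finner
      rw [Finsupp.sum_smul_index' (by simp), Finsupp.smul_sum]
      simp [mul_assoc])
    (by
      intro f g h
      simp [finner, mul_add, Finsupp.sum_add])
    (by
      intro c f g
      simp only [finner, Finsupp.smul_apply, smul_eq_mul, RingHom.id_apply, Finsupp.mul_sum]
      refine Finsupp.sum_congr fun u _ => ?_
      ring)

lemma sip_apply (n : ℕ) (φ ψ : FockV n) : sip n φ ψ = finner n φ ψ := rfl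

lemma sip_single (n : ℕ) (u : OccT n) (c : ℂ) (ψ : FockV n) :
    sip n (Finsupp.single u c) ψ = (starRingEnd ℂ) c * ψ u := by
  simp [sip_apply, finner]

lemma sip_single_right (n : ℕ) (u : OccT n) (c : ℂ) (ψ : FockV n) :
    sip n ψ (Finsupp.single u c) = (starRingEnd ℂ) (ψ u) * c := by
  induction ψ using Finsupp.induction_linear with
  | zero => simp
  | add f g hf hg => simp [hf, hg, add_mul]
  | single w d =>
    rw [sip_single, Finsupp.single_apply, Finsupp.single_apply]
    by_cases h : u = w
    · subst h; simp
    · have : ¬ w = u := fun e => h e.symm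
      simp [h, this]

lemma sip_conj (n : ℕ) (φ ψ : FockV n) : (starRingEnd ℂ) (sip n φ ψ) = sip n ψ φ := by
  induction φ using Finsupp.induction_linear with
  | zero => simp
  | add f g hf hg => simp [hf, hg]
  | single u c => rw [sip_single, sip_single_right]; simp [mul_comm]

lemma sip_self (n : ℕ) (φ : FockV n) : sip n φ φ = (nsq n φ : ℂ) := by
  simp only [sip_apply, finner, nsq, Finsupp.sum]
  push_cast
  refine Finset.sum_congr rfl fun u _ => ?_
  rw [Complex.normSq_eq_conj_mul_self]

lemma nsq_nonneg (n : ℕ) (φ : FockV n) : 0 ≤ nsq n φ :=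
  Finset.sum_nonneg fun _ _ => Complex.normSq_nonneg _

lemma sip_cre (n : ℕ) (x : BV n) (φ ψ : FockV n) : sip n (cre n x φ) ψ = sip n φ (ann n x ψ) := by
  induction φ using Finsupp.induction_linear with
  | zero => simp
  | add f g hf hg => simp [hf, hg]
  | single u c =>
    rw [cre_single, sip_single, sip_single, ann_apply]
    simp [mul_assoc]

lemma sip_mcre (n : ℕ) (x : BV n) (φ ψ : FockV n) :
    sip n (mcre n x φ) ψ = sip n φ (mann n x ψ) := by
  simp only [mcre, mann, LinearMap.smul_apply, LinearMap.sum_apply, map_smulₛₗ, map_sum, sip_cre,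
    Complex.conj_ofReal, RingHom.id_apply]

lemma sip_ann (n : ℕ) (x : BV n) (φ ψ : FockV n) : sip n (ann n x φ) ψ = sip n φ (cre n x ψ) := by
  rw [← sip_conj, ← sip_cre, sip_conj]

lemma sip_mann (n : ℕ) (x : BV n) (φ ψ : FockV n) :
    sip n (mann n x φ) ψ = sip n φ (mcre n x ψ) := by
  rw [← sip_conj, ← sip_mcre, sip_conj]

lemma sip_vac_cob (n : ℕ) (ψ : FockV n) : sip n (vac n) (cob n ψ) = sip n (vac n) ψ := by
  refine fock_induction n (fun ψ => sip n (vac n) (cob n ψ) = sip n (vac n) ψ) ?_ ?_ ?_ ?_ ψ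
  · simp only [cob_vac]
  · intro f g hf hg; simp [hf, hg]
  · intro c f hf; simp [hf]
  · intro x f hf
    rw [cob_cre, ← sip_mann, ← sip_ann, mann_vac, ann_vac]
    simp

lemma sip_cob (n : ℕ) (φ ψ : FockV n) : sip n (cob n φ) (cob n ψ) = sip n φ ψ := by
  refine fock_induction n (fun φ => ∀ ψ, sip n (cob n φ) (cob n ψ) = sip n φ ψ) ?_ ?_ ?_ ?_ φ ψ
  · intro ψ; rw [cob_vac, sip_vac_cob]
  · intro f g hf hg ψ; simp [hf, hg]
  · intro c f hf ψ; simp [hf]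
  · intro x f hf ψ
    rw [cob_cre, sip_mcre, ← cob_ann, hf, sip_cre]

lemma nsq_cob (n : ℕ) (φ : FockV n) : nsq n (cob n φ) = nsq n φ := by
  have h := sip_cob n φ φ
  rw [sip_self, sip_self] at h
  exact_mod_cast h

/-- AM-GM form of Cauchy-Schwarz. -/
lemma sip_amgm (n : ℕ) (a b : FockV n) (l : ℝ) (hl : 0 < l) :
    2 * (sip n a b).re ≤ l * nsq n a + l⁻¹ * nsq n b := by
  have h := nsq_nonneg n ((l : ℂ) • a - b)
  have e : sip n ((l : ℂ) • a - b) ((l : ℂ) • a - b) =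
      (l : ℂ) * l * sip n a a - l * sip n a b - l * (starRingEnd ℂ) (sip n a b) + sip n b b := by
    rw [sip_conj]
    simp only [map_sub, map_smulₛₗ, LinearMap.sub_apply, LinearMap.smul_apply, smul_eq_mul,
      Complex.conj_ofReal, RingHom.id_apply]
    ring
  have e2 := congrArg Complex.re e
  rw [sip_self, sip_self, sip_self] at e2
  simp only [Complex.add_re, Complex.sub_re, Complex.mul_re, Complex.ofReal_re, Complex.ofReal_im,
    Complex.conj_re, mul_zero, zero_mul, sub_zero, Complex.mul_im, add_zero] at e2
  rw [e2] at h
  have h3 : 0 ≤ l⁻¹ * (l * l * nsq n a - l * (sip n a b).re - l * (sip n a b).re + nsq n b) := by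
    positivity
  have h4 : l⁻¹ * (l * l * nsq n a - l * (sip n a b).re - l * (sip n a b).re + nsq n b)
      = l * nsq n a - 2 * (sip n a b).re + l⁻¹ * nsq n b := by
    field_simp; ring
  linarith

/-- Coefficients of the projection in the momentum basis. -/
noncomputable def projCoef (n ℓ : ℕ) (P : OccT n → Prop) [DecidablePred P] : FockOp n :=
  ∑ v : BV n → Fin (ℓ + 1),
    if (∑ x, ((v x : ℕ))) = ℓ ∧ P (fun x => (v x : ℕ))
    then (LinearMap.toSpanSingleton ℂ (FockV n) (Finsupp.single (fun x => (v x : ℕ)) 1)).comp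
      (sip n (momFock n (fun x => (v x : ℕ))))
    else 0

lemma projOn_eq (n ℓ : ℕ) (P : OccT n → Prop) [DecidablePred P] (ψ : FockV n) :
    projOn n ℓ P ψ = cob n (projCoef n ℓ P ψ) := by
  induction ψ using Finsupp.induction_linear with
  | zero => simp
  | add f g hf hg => simp only [map_add, hf, hg]
  | single w c =>
    simp only [projOn, projCoef, Finsupp.lift_apply, LinearMap.sum_apply, map_sum]
    rw [Finsupp.sum_single_index (by simp), Finset.smul_sum]
    refine Finset.sum_congr rfl fun v _ => ?_
    split_ifs
    · rw [LinearMap.comp_apply, LinearMap.toSpanSingleton_apply, map_smul, cob_single,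
        sip_single_right, one_smul, smul_smul, mul_comm]
    · simp

lemma projCoef_supp (n ℓ : ℕ) (P : OccT n → Prop) [DecidablePred P] (ψ : FockV n) (u : OccT n)
    (hu : projCoef n ℓ P ψ u ≠ 0) : ∑ x, u x = ℓ ∧ P u := by
  simp only [projCoef, LinearMap.sum_apply, Finsupp.finsetSum_apply] at hu
  obtain ⟨v, _, hv⟩ := Finset.exists_ne_zero_of_sum_ne_zero hu
  split_ifs at hv with h
  · simp only [LinearMap.comp_apply, LinearMap.toSpanSingleton_apply, Finsupp.smul_apply,
      Finsupp.single_apply, smul_eq_mul] at hv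
    split_ifs at hv with h2
    · rw [← h2]; exact h
    · simp at hv
  · simp at hv

lemma projOn_symm (n ℓ : ℕ) (P : OccT n → Prop) [DecidablePred P] (φ ψ : FockV n) :
    sip n (projOn n ℓ P φ) ψ = sip n φ (projOn n ℓ P ψ) := by
  rw [projOn_eq, projOn_eq]
  simp only [projCoef, LinearMap.sum_apply, map_sum]
  refine Finset.sum_congr rfl fun v _ => ?_
  split_ifs
  · simp [cob_single, sip_conj, mul_comm]
  · simp

lemma projOn_nsq (n ℓ : ℕ) (P : OccT n → Prop) [DecidablePred P] (ψ : FockV n) :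
    nsq n (projCoef n ℓ P ψ) ≤ nsq n ψ := by
  have key : ∀ u : OccT n, projCoef n ℓ P ψ u ≠ 0 →
      projCoef n ℓ P ψ u = sip n (momFock n u) ψ := by
    intro u hu
    obtain ⟨h1, h2⟩ := projCoef_supp n ℓ P ψ u hu
    have hb : ∀ x, u x < ℓ + 1 := by
      intro x
      have := Finset.single_le_sum (f := u) (fun _ _ => Nat.zero_le _) (Finset.mem_univ x)
      omega
    simp only [projCoef, LinearMap.sum_apply, Finsupp.finsetSum_apply]
    rw [Finset.sum_eq_single (fun x => (⟨u x, hb x⟩ : Fin (ℓ + 1)))]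
    · simp [h1, h2]
    · intro v _ hv
      split_ifs with h
      · have : (fun x => (v x : ℕ)) ≠ u := by
          intro e
          apply hv
          funext x
          apply Fin.ext
          exact congrFun e x
        simp [this]
      · simp
    · simp
  have e : sip n (cob n (projCoef n ℓ P ψ)) ψ = (nsq n (projCoef n ℓ P ψ) : ℂ) := by
    generalize hc : projCoef n ℓ P ψ = c at key
    have h1 : cob n c = c.sum fun u a => a • momFock n u := by simp [cob]
    rw [h1, Finsupp.sum, map_sum, LinearMap.sum_apply, ← sip_self, sip_apply n c c,
      finner, Finsupp.sum]
    refine Finset.sum_congr rfl fun u hu => ?_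
    have := key u (Finsupp.mem_support_iff.1 hu)
    rw [map_smulₛₗ, LinearMap.smul_apply, smul_eq_mul]
    rw [← this]
  have h := sip_amgm n (cob n (projCoef n ℓ P ψ)) ψ 1 one_pos
  rw [e, nsq_cob] at h
  simp at h
  linarith


lemma summ (n : ℕ) (φ : FockV n) (f : OccT n → ℝ) : Summable fun u => f u * ‖φ u‖ ^ 2 := by
  apply summable_of_hasFiniteSupport
  refine (φ.support.finite_toSet).subset ?_
  intro u hu
  simp only [Function.mem_support, ne_eq, mul_eq_zero, not_or] at hu
  simpa using hu.2

lemma nsq_eq_tsum (n : ℕ) (φ : FockV n) : nsq n φ = ∑' u, ‖φ u‖ ^ 2 := by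
  rw [nsq, Finsupp.sum, tsum_eq_sum (s := φ.support)]
  · simp [Complex.normSq_eq_norm_sq]
  · intro u hu
    simpa using hu

/-- weighted norm -/
noncomputable def wn (n : ℕ) (f : OccT n → ℝ) (φ : FockV n) : ℝ := ∑' u, f u * ‖φ u‖ ^ 2

lemma wn_one (n : ℕ) (φ : FockV n) : wn n (fun _ => 1) φ = nsq n φ := by
  rw [nsq_eq_tsum]; simp [wn]

lemma wn_mono (n : ℕ) (f g : OccT n → ℝ) (φ : FockV n) (h : ∀ u, φ u ≠ 0 → f u ≤ g u) :
    wn n f φ ≤ wn n g φ := by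
  refine Summable.tsum_le_tsum (fun u => ?_) (summ n φ f) (summ n φ g)
  by_cases h0 : φ u = 0
  · simp [h0]
  · exact mul_le_mul_of_nonneg_right (h u h0) (by positivity)

lemma up_inj (n : ℕ) (y : BV n) :
    Function.Injective fun w : OccT n => Function.update w y (w y + 1) := by
  intro a b h
  funext x
  have := congrFun h x
  by_cases hx : x = y
  · subst hx; simpa using this
  · simpa [hx] using this

/-- successive annihilation -/
noncomputable def annL (n : ℕ) : List (BV n) → FockV n → FockV n
  | [], φ => φ
  | z :: zs, φ => annL n zs (ann n z φ)

noncomputable def mannL (n : ℕ) : List (BV n) → FockV n → FockV n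
  | [], φ => φ
  | z :: zs, φ => mannL n zs (mann n z φ)

lemma annL_cob (n : ℕ) (l : List (BV n)) (φ : FockV n) :
    annL n l (cob n φ) = cob n (mannL n l φ) := by
  induction l generalizing φ with
  | nil => rfl
  | cons z l ih => simp only [annL, mannL, ann_cob, ih]

open Classical in
lemma annL_bound (n : ℕ) (l : List (BV n)) (hl : l.Nodup) (φ : FockV n) :
    wn n (fun u => if ∀ z ∈ l, 1 ≤ u z then 1 else 0) φ ≤ nsq n (annL n l φ) := by
  induction l generalizing φ with
  | nil => rw [← wn_one]; simp [annL]
  | cons z l ih =>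
    have hl' := List.nodup_cons.1 hl
    have hsm := (summ n φ (fun u => if ∀ x ∈ z :: l, 1 ≤ u x then 1 else 0)).comp_injective
      (up_inj n z)
    refine le_trans ?_ (ih hl'.2 (ann n z φ))
    unfold wn
    rw [← (up_inj n z).tsum_eq]
    · refine Summable.tsum_le_tsum (fun w => ?_) ?_ (summ n _ _)
      · rw [ann_apply, norm_mul, mul_pow]
        have e : ‖((Real.sqrt (w z + 1) : ℝ) : ℂ)‖ ^ 2 = w z + 1 := by
          rw [Complex.norm_real, Real.norm_eq_abs, sq_abs, Real.sq_sqrt (by positivity)]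
        rw [e]
        have hiff : (∀ x ∈ z :: l, 1 ≤ Function.update w z (w z + 1) x) ↔ ∀ x ∈ l, 1 ≤ w x := by
          constructor
          · intro h x hx
            have := h x (List.mem_cons_of_mem _ hx)
            rwa [Function.update_of_ne (fun e : x = z => hl'.1 (e ▸ hx))] at this
          · intro h x hx
            rcases List.mem_cons.1 hx with rfl | hx
            · simp
            · rw [Function.update_of_ne (fun e : x = z => hl'.1 (e ▸ hx))]
              exact h x hx
        simp only [hiff]
        split_ifs
        · have : (0:ℝ) ≤ w z * ‖φ (Function.update w z (w z + 1))‖ ^ 2 := by positivity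
          linarith
        · simp
      · exact hsm
    · intro u hu
      simp only [Function.mem_support, ne_eq, mul_eq_zero, not_or, ite_eq_right_iff,
        one_ne_zero, imp_false, not_not] at hu
      refine ⟨Function.update u z (u z - 1), ?_⟩
      have := hu.1 z (by simp)
      have e : u z - 1 + 1 = u z := by omega
      simp [e]

lemma oddCount_zero (n : ℕ) (w : OccT n) (k : ℕ) :
    oddCount n (Function.update w 0 k) = oddCount n w := by
  unfold oddCount
  congr 1
  ext x
  simp only [Finset.mem_filter, Finset.mem_univ, true_and]
  refine and_congr_right fun h => ?_
  rw [Function.update_of_ne h]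

lemma oddCount_even (n : ℕ) (w : OccT n) (y : BV n) (hy : y ≠ 0) (h : ¬ Odd (w y)) :
    oddCount n (Function.update w y (w y + 1)) = oddCount n w + 1 := by
  unfold oddCount
  rw [← Finset.card_insert_of_notMem (a := y)]
  · congr 1
    ext x
    simp only [Finset.mem_filter, Finset.mem_univ, true_and, Finset.mem_insert]
    by_cases hx : x = y
    · subst hx
      simp only [Function.update_self, true_or, iff_true]
      exact ⟨hy, by rw [Nat.odd_add_one]; exact h⟩
    · simp [hx]
  · simp [h]

lemma oddCount_odd (n : ℕ) (w : OccT n) (y : BV n) (hy : y ≠ 0) (h : Odd (w y)) :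
    oddCount n w = oddCount n (Function.update w y (w y + 1)) + 1 := by
  have h2 : ¬ Odd (Function.update w y (w y + 1) y) := by
    rw [Function.update_self, Nat.odd_add_one]; simpa using h
  rw [← oddCount_even n _ y hy h2]
  unfold oddCount
  congr 1
  ext x
  simp only [Finset.mem_filter, Finset.mem_univ, true_and]
  refine and_congr_right fun _ => ?_
  by_cases hx : x = y
  · subst hx
    simp only [Function.update_self, Nat.odd_add_one, not_not]
  · simp [hx]

/-- number of bosons in nonzero modes -/
def nz (n : ℕ) (u : OccT n) : ℕ := ∑ y ∈ Finset.univ.erase 0, u y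

lemma oddCount_le_nz (n : ℕ) (u : OccT n) : oddCount n u ≤ nz n u := by
  unfold oddCount nz
  rw [Finset.card_filter]
  rw [← Finset.add_sum_erase _ _ (Finset.mem_univ (0 : BV n))]
  simp only [ne_eq, not_true_eq_false, false_and, if_false, zero_add]
  refine Finset.sum_le_sum fun y _ => ?_
  split_ifs with h
  · exact h.2.pos
  · exact Nat.zero_le _

lemma nz_up (n : ℕ) (w : OccT n) (y : BV n) : nz n w ≤ nz n (Function.update w y (w y + 1)) := by
  refine Finset.sum_le_sum fun x _ => ?_
  by_cases hx : x = y
  · subst hx; simp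
  · simp [hx]

/-- support condition -/
def Good (n ℓ r : ℕ) (φ : FockV n) : Prop := ∀ u, φ u ≠ 0 → u 0 ≤ ℓ ∧ nz n u ≤ r

lemma mann_apply (n : ℕ) (z : BV n) (φ : FockV n) (w : OccT n) :
    mann n z φ w = (((Real.sqrt ((2 : ℝ) ^ n))⁻¹ : ℝ) : ℂ) * ∑ y : BV n, ((chiR y z : ℝ) : ℂ) *
      (((Real.sqrt (w y + 1) : ℝ) : ℂ) * φ (Function.update w y (w y + 1))) := by
  simp only [mann, LinearMap.smul_apply, LinearMap.sum_apply, Finsupp.smul_apply,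
    Finsupp.finsetSum_apply, ann_apply, smul_eq_mul]

lemma good_mann (n ℓ r : ℕ) (z : BV n) (φ : FockV n) (h : Good n ℓ r φ) :
    Good n ℓ r (mann n z φ) := by
  intro w hw
  rw [mann_apply] at hw
  obtain ⟨y, _, hy⟩ := Finset.exists_ne_zero_of_sum_ne_zero (right_ne_zero_of_mul hw)
  have h1 := h _ (right_ne_zero_of_mul (right_ne_zero_of_mul hy))
  refine ⟨le_trans ?_ h1.1, (nz_up n w y).trans h1.2⟩
  by_cases hx : (0 : BV n) = y
  · subst hx; simp
  · simp [hx]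

lemma step_pointwise (n ℓ r : ℕ) (z : BV n) (φ : FockV n) (h : Good n ℓ r φ) (s : ℝ)
    (hs : s = Real.sqrt ((2 : ℝ) ^ n)) (w : OccT n) :
    s ^ oddCount n w * ‖mann n z φ w‖ ^ 2 ≤ (s⁻¹ * (r + 2)) *
      ∑ y : BV n, (fun u : OccT n => (if y = 0 then s⁻¹ else 1) * u y * s ^ oddCount n u * ‖φ u‖ ^ 2)
        (Function.update w y (w y + 1)) := by
  have hs0 : 0 < s := by rw [hs]; positivity
  have hss : s * s = 2 ^ n := by rw [hs]; exact Real.mul_self_sqrt (by positivity)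
  by_cases hw : r < nz n w
  · have hz : ∀ y, φ (Function.update w y (w y + 1)) = 0 := by
      intro y
      by_contra hc
      have := (h _ hc).2
      have := nz_up n w y
      omega
    rw [mann_apply]
    simp [hz]
  · push Not at hw
    set β : BV n → ℝ := fun y => if y = 0 then s else if Odd (w y) then s else s⁻¹ with hβ
    have hβ0 : ∀ y, 0 < β y := by
      intro y; simp only [hβ]; split_ifs <;> positivity
    set q : BV n → ℝ := fun y => Real.sqrt (w y + 1) * ‖φ (Function.update w y (w y + 1))‖ with hq
    set g : BV n → ℝ := fun y => (w y + 1) * ‖φ (Function.update w y (w y + 1))‖ ^ 2 / β y with hg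
    have h1 : ‖mann n z φ w‖ ≤ s⁻¹ * ∑ y, q y := by
      rw [mann_apply, norm_mul, ← hs, Complex.norm_real, Real.norm_eq_abs,
        abs_of_pos (inv_pos.2 hs0)]
      refine mul_le_mul_of_nonneg_left ?_ (by positivity)
      refine (norm_sum_le _ _).trans (Finset.sum_le_sum fun y _ => ?_)
      rw [norm_mul, norm_mul, Complex.norm_real, Complex.norm_real, Real.norm_eq_abs, chiR_abs,
        one_mul, Real.norm_eq_abs, abs_of_nonneg (Real.sqrt_nonneg _)]
    have h2 : (∑ y, q y) ^ 2 ≤ (∑ y, β y) * ∑ y, g y := by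
      refine Finset.sum_sq_le_sum_mul_sum_of_sq_le_mul _ (fun y _ => (hβ0 y).le) (fun y _ => ?_)
        (fun y _ => ?_)
      · have := hβ0 y
        simp only [hg]; positivity
      · have := (hβ0 y).ne'
        simp only [hg, hq]
        rw [mul_pow, Real.sq_sqrt (by positivity)]
        apply le_of_eq
        field_simp
    have h3 : ∑ y, β y ≤ s * (r + 2) := by
      have hle : ∀ y, β y ≤ (if y = 0 then s else 0) + (if y ≠ 0 ∧ Odd (w y) then s else 0) + s⁻¹ := by
        intro y
        have := inv_pos.2 hs0
        by_cases hy : y = 0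
        · simp [hβ, hy]; linarith
        · by_cases ho : Odd (w y)
          · simp [hβ, hy, ho]; linarith
          · simp [hβ, hy, ho]
      refine (Finset.sum_le_sum fun y _ => hle y).trans ?_
      rw [Finset.sum_add_distrib, Finset.sum_add_distrib, Finset.sum_ite_eq',
        if_pos (Finset.mem_univ _), ← Finset.sum_filter _ (fun _ => s),
        Finset.sum_const, Finset.sum_const]
      have ho : ((Finset.univ.filter fun x : BV n => x ≠ 0 ∧ Odd (w x)).card : ℝ) ≤ r := by
        exact_mod_cast (oddCount_le_nz n w).trans hw
      have hN : ((Finset.univ : Finset (BV n)).card : ℝ) * s⁻¹ = s := by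
        have : ((Finset.univ : Finset (BV n)).card : ℝ) = 2 ^ n := by simp
        rw [this, ← hss]; field_simp
      rw [nsmul_eq_mul, nsmul_eq_mul, hN]
      nlinarith
    have h4 : ∀ y, s ^ oddCount n w * g y =
        (fun u : OccT n => (if y = 0 then s⁻¹ else 1) * u y * s ^ oddCount n u * ‖φ u‖ ^ 2)
        (Function.update w y (w y + 1)) := by
      intro y
      simp only [hg, Function.update_self]
      push_cast
      by_cases hy : y = 0
      · subst hy
        rw [oddCount_zero]
        simp only [hβ, if_true]
        field_simp
      · by_cases ho : Odd (w y)
        · simp only [hβ, hy, ho, if_true, if_false]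
          rw [oddCount_odd n w y hy ho, pow_succ]
          field_simp
        · simp only [hβ, hy, ho, if_false]
          rw [oddCount_even n w y hy ho]
          field_simp
          ring
    have hg0 : 0 ≤ ∑ y, g y := Finset.sum_nonneg fun y _ => by
      have := hβ0 y
      simp only [hg]; positivity
    have hq0 : 0 ≤ ∑ y, q y := Finset.sum_nonneg fun y _ => by simp only [hq]; positivity
    calc s ^ oddCount n w * ‖mann n z φ w‖ ^ 2
        ≤ s ^ oddCount n w * (s⁻¹ * ∑ y, q y) ^ 2 := by gcongr
      _ = s ^ oddCount n w * (s⁻¹ ^ 2 * (∑ y, q y) ^ 2) := by rw [mul_pow]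
      _ ≤ s ^ oddCount n w * (s⁻¹ ^ 2 * ((s * (r + 2)) * ∑ y, g y)) := by
        gcongr
        exact h2.trans (mul_le_mul_of_nonneg_right h3 hg0)
      _ = (s⁻¹ * (r + 2)) * ∑ y, s ^ oddCount n w * g y := by
        rw [← Finset.mul_sum]; field_simp
      _ = _ := by
        congr 1
        exact Finset.sum_congr rfl fun y _ => h4 y

lemma step_bound (n ℓ r : ℕ) (z : BV n) (φ : FockV n) (h : Good n ℓ r φ) (s : ℝ)
    (hs : s = Real.sqrt ((2 : ℝ) ^ n)) (hℓ : (ℓ : ℝ) ≤ s) :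
    wn n (fun u => s ^ oddCount n u) (mann n z φ) ≤
      (s⁻¹ * (r + 2) * (r + 1)) * wn n (fun u => s ^ oddCount n u) φ := by
  have hs0 : 0 < s := by rw [hs]; positivity
  have hsum : ∀ y : BV n, Summable (fun u : OccT n =>
      (if y = 0 then s⁻¹ else 1) * u y * s ^ oddCount n u * ‖φ u‖ ^ 2) := fun y => summ n φ _
  have hsum2 := fun y : BV n => (hsum y).comp_injective (up_inj n y)
  calc wn n (fun u => s ^ oddCount n u) (mann n z φ)
      ≤ ∑' w : OccT n, (s⁻¹ * (r + 2)) * ∑ y : BV n,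
        (fun u : OccT n => (if y = 0 then s⁻¹ else 1) * u y * s ^ oddCount n u * ‖φ u‖ ^ 2)
        (Function.update w y (w y + 1)) := by
        refine Summable.tsum_le_tsum (fun w => step_pointwise n ℓ r z φ h s hs w) (summ n _ _) ?_
        refine Summable.mul_left _ ?_
        exact summable_sum fun y _ => hsum2 y
    _ = (s⁻¹ * (r + 2)) * ∑ y : BV n, ∑' w : OccT n,
        (fun u : OccT n => (if y = 0 then s⁻¹ else 1) * u y * s ^ oddCount n u * ‖φ u‖ ^ 2)
        (Function.update w y (w y + 1)) := by
        rw [tsum_mul_left, Summable.tsum_finsetSum]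
        exact fun y _ => hsum2 y
    _ ≤ (s⁻¹ * (r + 2)) * ∑ y : BV n, ∑' u : OccT n,
        (if y = 0 then s⁻¹ else 1) * u y * s ^ oddCount n u * ‖φ u‖ ^ 2 := by
        refine mul_le_mul_of_nonneg_left ?_ (by positivity)
        refine Finset.sum_le_sum fun y _ => ?_
        refine tsum_comp_le_tsum_of_inj (hsum y) (fun u => ?_) (up_inj n y)
        split_ifs <;> positivity
    _ = (s⁻¹ * (r + 2)) * wn n (fun u => ∑ y : BV n, (if y = 0 then s⁻¹ else 1) * u y * s ^ oddCount n u) φ := by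
        rw [← Summable.tsum_finsetSum (fun y _ => hsum y)]
        simp only [wn, Finset.sum_mul]
    _ ≤ (s⁻¹ * (r + 2)) * wn n (fun u => (r + 1) * s ^ oddCount n u) φ := by
        refine mul_le_mul_of_nonneg_left ?_ (by positivity)
        refine wn_mono n _ _ _ fun u hu => ?_
        rw [← Finset.sum_mul]
        refine mul_le_mul_of_nonneg_right ?_ (by positivity)
        rw [← Finset.add_sum_erase _ _ (Finset.mem_univ (0 : BV n))]
        obtain ⟨g1, g2⟩ := h u hu
        have e1 : ∑ y ∈ Finset.univ.erase (0 : BV n), (if y = 0 then s⁻¹ else 1) * (u y : ℝ) = nz n u := by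
          unfold nz
          push_cast
          refine Finset.sum_congr rfl fun y hy => ?_
          simp [Finset.ne_of_mem_erase hy]
        rw [e1, if_pos rfl]
        have g1' : (u 0 : ℝ) ≤ ℓ := by exact_mod_cast g1
        have g2' : (nz n u : ℝ) ≤ r := by exact_mod_cast g2
        have : s⁻¹ * (u 0 : ℝ) ≤ 1 := by
          rw [inv_mul_le_iff₀ hs0]; linarith
        linarith
    _ = _ := by
        have : wn n (fun u => (r + 1) * s ^ oddCount n u) φ = (r + 1) * wn n (fun u => s ^ oddCount n u) φ := by
          simp only [wn, mul_assoc, tsum_mul_left]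
        rw [this]; ring

lemma mannL_bound (n ℓ r : ℕ) (l : List (BV n)) (φ : FockV n) (h : Good n ℓ r φ) (s : ℝ)
    (hs : s = Real.sqrt ((2 : ℝ) ^ n)) (hℓ : (ℓ : ℝ) ≤ s) :
    wn n (fun u => s ^ oddCount n u) (mannL n l φ) ≤
      (s⁻¹ * (r + 2) * (r + 1)) ^ l.length * wn n (fun u => s ^ oddCount n u) φ := by
  have hs0 : 0 < s := by rw [hs]; positivity
  induction l generalizing φ with
  | nil => simp [mannL]
  | cons z l ih =>
    refine (ih _ (good_mann n ℓ r z φ h)).trans ?_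
    refine (mul_le_mul_of_nonneg_left (step_bound n ℓ r z φ h s hs hℓ) (by positivity)).trans ?_
    rw [List.length_cons, pow_succ]
    apply le_of_eq
    ring

lemma one_le_s (n : ℕ) : 1 ≤ Real.sqrt ((2 : ℝ) ^ n) := by
  rw [Real.one_le_sqrt]
  exact one_le_pow₀ (by norm_num)

open Classical in
lemma proj_bound (n ℓ r o : ℕ) (l : List (BV n)) (hl : l.Nodup) (ψ : FockV n) (s : ℝ)
    (hs : s = Real.sqrt ((2 : ℝ) ^ n)) (hℓ : (ℓ : ℝ) ≤ s) :
    wn n (fun u => if ∀ z ∈ l, 1 ≤ u z then 1 else 0) (QEC n ℓ r o ψ) ≤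
      (s⁻¹ * (r + 2) * (r + 1)) ^ l.length * s ^ o * nsq n ψ := by
  have hs0 : 0 < s := by rw [hs]; positivity
  have hs1 : 1 ≤ s := by rw [hs]; exact one_le_s n
  refine (annL_bound n l hl _).trans ?_
  unfold QEC
  rw [projOn_eq, annL_cob, nsq_cob]
  set c := projCoef n ℓ (fun u => ℓ - r ≤ u 0 ∧ oddCount n u ≤ o) ψ with hc
  have hgood : Good n ℓ r c := by
    intro u hu
    obtain ⟨h1, h2, h3⟩ := projCoef_supp n ℓ _ ψ u hu
    have := Finset.add_sum_erase Finset.univ u (Finset.mem_univ (0 : BV n))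
    unfold nz
    omega
  have h1 : nsq n (mannL n l c) ≤ wn n (fun u => s ^ oddCount n u) (mannL n l c) := by
    rw [← wn_one]
    exact wn_mono n _ _ _ fun u _ => one_le_pow₀ hs1
  have h2 : wn n (fun u => s ^ oddCount n u) c ≤ s ^ o * nsq n c := by
    have : s ^ o * nsq n c = wn n (fun _ => s ^ o) c := by
      rw [nsq_eq_tsum, wn, tsum_mul_left]
    rw [this]
    refine wn_mono n _ _ _ fun u hu => ?_
    obtain ⟨_, _, h3⟩ := projCoef_supp n ℓ _ ψ u hu
    exact pow_le_pow_right₀ hs1 h3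
  have h3 : nsq n c ≤ nsq n ψ := projOn_nsq n ℓ _ ψ
  refine h1.trans ((mannL_bound n ℓ r l c hgood s hs hℓ).trans ?_)
  have h4 : 0 ≤ (s⁻¹ * ((r : ℝ) + 2) * (r + 1)) ^ l.length := by positivity
  have h5 := mul_le_mul_of_nonneg_left
    (h2.trans (mul_le_mul_of_nonneg_left h3 (pow_nonneg hs0.le o))) h4
  refine h5.trans (le_of_eq ?_)
  ring

lemma sip_filter (n : ℕ) (p : OccT n → Prop) [DecidablePred p] (a b : FockV n) :
    sip n (a.filter p) b = sip n a (b.filter p) := by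
  induction a using Finsupp.induction_linear with
  | zero => simp [Finsupp.filter_zero]
  | add f g hf hg => simp [Finsupp.filter_add, hf, hg]
  | single u c =>
    by_cases h : p u
    · rw [Finsupp.filter_single_of_pos _ h, sip_single, sip_single, Finsupp.filter_apply_pos _ _ h]
    · rw [Finsupp.filter_single_of_neg _ h, sip_single, Finsupp.filter_apply_neg _ _ h]
      simp

lemma filter_idem (n : ℕ) (p : OccT n → Prop) [DecidablePred p] (a : FockV n) :
    (a.filter p).filter p = a.filter p := by
  ext u
  by_cases h : p u <;> simp [Finsupp.filter_apply, h]

lemma sandwich (n ℓ : ℕ) (P : OccT n → Prop) [DecidablePred P] (p : OccT n → Prop) [DecidablePred p]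
    (B : ℝ) (hB : 0 ≤ B) (h : ∀ ψ, nsq n ((projOn n ℓ P ψ).filter p) ≤ B * nsq n ψ) (ψ : FockV n) :
    nsq n (projOn n ℓ P ((projOn n ℓ P ψ).filter p)) ≤ B ^ 2 * nsq n ψ := by
  set η := projOn n ℓ P ((projOn n ℓ P ψ).filter p) with hη
  have e : sip n ((projOn n ℓ P η).filter p) ((projOn n ℓ P ψ).filter p) = (nsq n η : ℂ) := by
    rw [sip_filter, filter_idem, projOn_symm, ← hη, sip_self]
  have h1 := h η
  have h2 := h ψ
  have key : ∀ l : ℝ, 0 < l → 2 * nsq n η ≤ l * (B * nsq n η) + l⁻¹ * (B * nsq n ψ) := by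
    intro l hl
    have := sip_amgm n ((projOn n ℓ P η).filter p) ((projOn n ℓ P ψ).filter p) l hl
    rw [e, Complex.ofReal_re] at this
    refine this.trans (add_le_add ?_ ?_)
    · exact mul_le_mul_of_nonneg_left h1 hl.le
    · exact mul_le_mul_of_nonneg_left h2 (inv_nonneg.2 hl.le)
  rcases hB.eq_or_lt with h0 | h0
  · have := key 1 one_pos
    rw [← h0] at this ⊢
    simp at this ⊢
    linarith
  · have := key B⁻¹ (inv_pos.2 h0)
    rw [inv_inv, ← mul_assoc, inv_mul_cancel₀ h0.ne'] at this
    nlinarith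

lemma nsq_filter (n : ℕ) (p : OccT n → Prop) [DecidablePred p] (φ : FockV n) :
    nsq n (φ.filter p) = wn n (fun u => if p u then 1 else 0) φ := by
  rw [nsq_eq_tsum, wn]
  congr 1
  funext u
  by_cases h : p u <;> simp [Finsupp.filter_apply, h]

/-- slice of a combined state at guess `z` -/
noncomputable def sl (n v : ℕ) (z : Fin v → BV n) : WSp n v →ₗ[ℂ] FockV n :=
  Finsupp.lcomapDomain (fun u => (z, u)) (Prod.mk_right_injective z)

lemma sl_apply (n v : ℕ) (z : Fin v → BV n) (ψ : WSp n v) (u : OccT n) :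
    sl n v z ψ u = ψ (z, u) := rfl

lemma nsqW_eq (n v : ℕ) (ψ : WSp n v) : nsqW n v ψ = ∑ z, nsq n (sl n v z ψ) := by
  have hs : Summable fun p : WIdx n v => ‖ψ p‖ ^ 2 := by
    apply summable_of_hasFiniteSupport
    refine (ψ.support.finite_toSet).subset ?_
    intro u hu
    simpa using hu
  have h1 : nsqW n v ψ = ∑' p, ‖ψ p‖ ^ 2 := by
    rw [nsqW, Finsupp.sum, tsum_eq_sum (s := ψ.support)]
    · simp [Complex.normSq_eq_norm_sq]
    · intro u hu
      simpa using hu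
  rw [h1, hs.tsum_prod, tsum_fintype]
  refine Finset.sum_congr rfl fun z _ => ?_
  rw [nsq_eq_tsum]
  rfl

lemma sl_tensorR (n v : ℕ) (A : FockOp n) (z : Fin v → BV n) (ψ : WSp n v) :
    sl n v z (tensorR n v A ψ) = A (sl n v z ψ) := by
  induction ψ using Finsupp.induction_linear with
  | zero => simp
  | add f g hf hg => simp only [map_add, hf, hg]
  | single p c =>
    obtain ⟨z', u⟩ := p
    have e1 : tensorR n v A (Finsupp.single (z', u) c)
        = c • Finsupp.mapDomain (fun u => (z', u)) (A (Finsupp.single u 1)) := by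
      simp [tensorR]
    rw [e1, map_smul]
    by_cases h : z' = z
    · subst h
      have e2 : sl n v z' (Finsupp.single (z', u) c) = c • Finsupp.single u 1 := by
        ext w
        rw [sl_apply]
        simp [Finsupp.single_apply]
      rw [e2, map_smul]
      congr 1
      ext w
      rw [sl_apply]
      exact Finsupp.mapDomain_apply (Prod.mk_right_injective z') _ _
    · have e2 : sl n v z (Finsupp.single (z', u) c) = 0 := by
        ext w
        rw [sl_apply]
        simp [Finsupp.single_apply, h]
      rw [e2, map_zero]
      have e3 : sl n v z (Finsupp.mapDomain (fun u => (z', u)) (A (Finsupp.single u 1))) = 0 := by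
        ext w
        rw [sl_apply]
        apply Finsupp.mapDomain_of_notMem_range
        rintro ⟨u', hu'⟩
        exact h (congrArg Prod.fst hu')
      rw [e3, smul_zero]

open Classical in
lemma sl_succProj (n ℓ v : ℕ) (z : Fin v → BV n) (ψ : WSp n v) :
    sl n v z (succProj n ℓ v ψ) = (sl n v z ψ).filter
      (fun u => Function.Injective z ∧ (∑ x, u x) = ℓ ∧ ∀ i : Fin v, 1 ≤ u (z i)) := by
  induction ψ using Finsupp.induction_linear with
  | zero => simp [Finsupp.filter_zero]
  | add f g hf hg => simp only [map_add, hf, hg, Finsupp.filter_add]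
  | single p c =>
    obtain ⟨z', u⟩ := p
    have e1 : succProj n ℓ v (Finsupp.single (z', u) c)
        = if Function.Injective z' ∧ (∑ x, u x) = ℓ ∧ ∀ i : Fin v, 1 ≤ u (z' i)
          then Finsupp.single (z', u) c else 0 := by
      simp only [succProj, Finsupp.lift_apply]
      rw [Finsupp.sum_single_index (by simp)]
      split_ifs <;> simp
    rw [e1]
    ext w
    rw [sl_apply, Finsupp.filter_apply, sl_apply, Finsupp.single_apply]
    by_cases h : (z', u) = (z, w)
    · obtain ⟨rfl, rfl⟩ := Prod.mk.injEq .. ▸ h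
      split_ifs <;> simp_all
    · split_ifs <;> simp_all

end helpers
/-- success-projector norm bound on quasi-even condensates.
For `v` a positive multiple of `4` and `r ≥ 3`,
`‖(id ⊗ QEC_{(r,v/4)}) · Π_succ · (id ⊗ QEC_{(r,v/4)})‖ ≤ 2·(4v(r³+vr²)√ℓ/2^{n/4})^v`. -/
theorem succ_proj_norm_bound (n ℓ v r : ℕ) (hv4 : 4 ∣ v) (hv : 0 < v) (hr : 3 ≤ r) :
    ∀ ψ : WSp n v,
      nsqW n v ((tensorR n v (QEC n ℓ r (v / 4)))
          ((succProj n ℓ v) ((tensorR n v (QEC n ℓ r (v / 4))) ψ)))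
        ≤ (2 * (4 * (v : ℝ) * ((r : ℝ) ^ 3 + (v : ℝ) * (r : ℝ) ^ 2) * Real.sqrt (ℓ : ℝ)
              / (2 : ℝ) ^ ((n : ℝ) / 4)) ^ v) ^ 2 * nsqW n v ψ := by
  classical
  intro ψ
  set X : ℝ := 4 * (v : ℝ) * ((r : ℝ) ^ 3 + (v : ℝ) * (r : ℝ) ^ 2) * Real.sqrt (ℓ : ℝ)
              / (2 : ℝ) ^ ((n : ℝ) / 4) with hX
  have hX0 : 0 ≤ X := by positivity
  have hB0 : 0 ≤ 2 * X ^ v := by positivity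
  rw [nsqW_eq, nsqW_eq, Finset.mul_sum]
  refine Finset.sum_le_sum fun z _ => ?_
  rw [sl_tensorR, sl_succProj, sl_tensorR]
  refine sandwich n ℓ _ _ _ hB0 (fun φ => ?_) _
  change nsq n ((QEC n ℓ r (v / 4) φ).filter _) ≤ _
  have hφ := nsq_nonneg n φ
  rw [nsq_filter]
  by_cases hz : Function.Injective z
  swap
  · simp only [hz, false_and, if_false]
    simp only [wn, zero_mul, tsum_zero]
    positivity
  rcases Nat.eq_zero_or_pos ℓ with h0 | h0
  · have : wn n (fun u => if Function.Injective z ∧ (∑ x, u x) = ℓ ∧ ∀ i : Fin v, 1 ≤ u (z i) then 1 else 0)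
        (QEC n ℓ r (v / 4) φ) ≤ wn n (fun _ => 0) (QEC n ℓ r (v / 4) φ) := by
      refine wn_mono n _ _ _ fun u _ => ?_
      rw [if_neg]
      rintro ⟨_, h1, h2⟩
      have h3 := h2 ⟨0, hv⟩
      rw [h0] at h1
      have := (Finset.sum_eq_zero_iff.1 h1) (z ⟨0, hv⟩) (Finset.mem_univ _)
      omega
    refine this.trans ?_
    simp only [wn, zero_mul, tsum_zero]
    positivity
  set s := Real.sqrt ((2 : ℝ) ^ n) with hs
  set q : ℝ := (2 : ℝ) ^ ((n : ℝ) / 4) with hq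
  have hq0 : 0 < q := by positivity
  have hqs : q ^ 2 = s := by
    rw [hq, hs, Real.sqrt_eq_rpow, ← Real.rpow_natCast, ← Real.rpow_natCast, ← Real.rpow_mul (by norm_num),
      ← Real.rpow_mul (by norm_num)]
    congr 1
    push_cast
    ring
  have hs1 : 1 ≤ s := one_le_s n
  have hq1 : 1 ≤ q := by
    by_contra hc
    push Not at hc
    nlinarith
  have hr' : (3 : ℝ) ≤ r := by exact_mod_cast hr
  have hv' : (1 : ℝ) ≤ v := by exact_mod_cast hv
  have hℓ' : (1 : ℝ) ≤ ℓ := by exact_mod_cast h0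
  have hC : ((r : ℝ) + 2) * (r + 1) ≤ 4 * (v : ℝ) * ((r : ℝ) ^ 3 + (v : ℝ) * (r : ℝ) ^ 2) := by
    have a1 : ((r : ℝ) + 2) * (r + 1) ≤ 4 * r ^ 3 := by nlinarith [mul_nonneg (show (0:ℝ) ≤ r by linarith) (show (0:ℝ) ≤ r by linarith)]
    have a2 : (r : ℝ) ^ 3 ≤ (r : ℝ) ^ 3 + (v : ℝ) * (r : ℝ) ^ 2 := by
      have : 0 ≤ (v : ℝ) * (r : ℝ) ^ 2 := by positivity
      linarith
    have a3 : 0 ≤ (r : ℝ) ^ 3 + (v : ℝ) * (r : ℝ) ^ 2 := by positivity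
    nlinarith
  have hC1 : 1 ≤ ((r : ℝ) + 2) * (r + 1) := by nlinarith
  by_cases hls : (ℓ : ℝ) ≤ s
  · have hnd : (List.ofFn z).Nodup := List.nodup_ofFn.2 hz
    have h1 := proj_bound n ℓ r (v / 4) (List.ofFn z) hnd φ s rfl hls
    refine le_trans (wn_mono n _ _ _ fun u _ => ?_) (h1.trans ?_)
    · by_cases hc : Function.Injective z ∧ (∑ x, u x) = ℓ ∧ ∀ i : Fin v, 1 ≤ u (z i)
      · rw [if_pos hc, if_pos]
        intro x hx
        obtain ⟨i, rfl⟩ := (List.mem_ofFn' _ _).1 hx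
        exact hc.2.2 i
      · rw [if_neg hc]
        split_ifs <;> norm_num
    · refine mul_le_mul_of_nonneg_right ?_ hφ
      rw [List.length_ofFn]
      have b1 : s ^ (v / 4) ≤ q ^ v := by
        rw [← hqs, ← pow_mul]
        exact pow_le_pow_right₀ hq1 (by omega)
      have b2 : s⁻¹ * (r + 2) * (r + 1) * q ≤ X := by
        have : s⁻¹ * (r + 2) * (r + 1) * q = ((r + 2) * (r + 1)) * 1 / q := by
          rw [← hqs]; field_simp
        rw [this, hX]
        gcongr
        exact Real.one_le_sqrt.2 hℓ'
      calc (s⁻¹ * (r + 2) * (r + 1)) ^ v * s ^ (v / 4)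
          ≤ (s⁻¹ * (r + 2) * (r + 1)) ^ v * q ^ v := by gcongr
        _ = (s⁻¹ * (r + 2) * (r + 1) * q) ^ v := by rw [mul_pow _ q]
        _ ≤ X ^ v := by gcongr
        _ ≤ 2 * X ^ v := by linarith [pow_nonneg hX0 v]
  · push Not at hls
    have hX1 : 1 ≤ X := by
      rw [hX, le_div_iff₀ hq0]
      have : q ≤ Real.sqrt ℓ := by
        apply Real.le_sqrt_of_sq_le
        rw [hqs]; exact hls.le
      have hC2 := hC1.trans hC
      nlinarith
    have h1 : wn n (fun u => if Function.Injective z ∧ (∑ x, u x) = ℓ ∧ ∀ i : Fin v, 1 ≤ u (z i) then 1 else 0)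
        (QEC n ℓ r (v / 4) φ) ≤ nsq n φ := by
      refine le_trans (wn_mono n _ (fun _ => 1) _ fun u _ => ?_) ?_
      · split_ifs <;> norm_num
      · rw [wn_one, QEC, projOn_eq, nsq_cob]
        exact projOn_nsq n ℓ _ φ
    refine h1.trans ?_
    have : 1 ≤ X ^ v := one_le_pow₀ hX1
    nlinarith
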